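/- arXiv:2403.05704 — 2 statements merged into one kernel-verified Lean document; each statement's English description precedes it below -/
import Mathlib

section
/- Let a and q be real numbers, and let x : ℕ → ℝ satisfy x(0) = 1 and, for every T ≥ 1, x(T) = a · Σ_{t=0}^{T−1} x(t) · q^{T−t}. Then for every T ≥ 1, x(T) = a · (1 + a)^{T−1} · q^T. -/
/-- Closed-form solution of the recursion for expected activated catchment regions in the
exponential case: if `x 0 = 1` and `x T = a · ∑_{t<T} x t · q^(T-t)` for all `T ≥ 1`, then
`x T = a · (1+a)^(T-1) · q^T` for all `T ≥ 1`. -/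
theorem catchment_recursion_closed_form
    (a q : ℝ) (x : ℕ → ℝ) (hx0 : x 0 = 1)
    (hrec : ∀ T : ℕ, 1 ≤ T → x T = a * ∑ t ∈ Finset.range T, x t * q ^ (T - t)) :
    ∀ T : ℕ, 1 ≤ T → x T = a * (1 + a) ^ (T - 1) * q ^ T := by
  have key : ∀ n : ℕ, ∑ t ∈ Finset.range (n + 1), x t * q ^ (n + 1 - t)
      = (1 + a) ^ n * q ^ (n + 1) := by
    intro n
    induction n with
    | zero => simp [hx0]
    | succ k ih =>
      have h1 : ∑ t ∈ Finset.range (k + 1), x t * q ^ (k + 1 + 1 - t)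
          = q * ∑ t ∈ Finset.range (k + 1), x t * q ^ (k + 1 - t) := by
        rw [Finset.mul_sum]
        refine Finset.sum_congr rfl fun t ht => ?_
        have ht' : t ≤ k + 1 := (Finset.mem_range.mp ht).le
        rw [Nat.succ_sub ht', pow_succ]
        ring
      have h2 : k + 1 + 1 - (k + 1) = 1 := by omega
      rw [Finset.sum_range_succ, h1, h2, hrec (k + 1) (by omega), ih]
      ring
  intro T hT
  obtain ⟨n, rfl⟩ : ∃ n, T = n + 1 := ⟨T - 1, by omega⟩
  rw [hrec (n + 1) hT, key n, Nat.add_sub_cancel]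
  ring
end

section
/- Let q ≥ 1 be a natural number, let (T_n) be a sequence of even natural numbers with T_n ≥ 2, and let (b_n) be a sequence of nonnegative reals such that b_n · T_n^q → ∞ as n → ∞. Then T_n^{q+1} / (T_n^{q+1} + b_n · Σ_{s=0}^{T_n−1} s^q (T_n−s)^{q+1}) → 0 as n → ∞ (all terms cast to ℝ). -/
open Filter

/-- Analytic core of the polynomial forecast-error theorem: with `b n ≥ 0`, even `T n ≥ 2`, and
`b n · (T n)^q → ∞`, the ratio
`T_n^(q+1) / (T_n^(q+1) + b n · ∑_{s<T n} s^q (T n - s)^(q+1))` tends to zero. -/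
theorem polynomial_forecast_ratio_tendsto_zero
    (q : ℕ) (hq : 1 ≤ q)
    (T : ℕ → ℕ) (hT2 : ∀ n, 2 ≤ T n) (hTeven : ∀ n, Even (T n))
    (b : ℕ → ℝ) (hb : ∀ n, 0 ≤ b n)
    (hbT : Tendsto (fun n => b n * (T n : ℝ) ^ q) atTop atTop) :
    Tendsto (fun n =>
        (T n : ℝ) ^ (q + 1) /
          ((T n : ℝ) ^ (q + 1) +
            b n * ∑ s ∈ Finset.range (T n), (s : ℝ) ^ q * ((T n - s : ℕ) : ℝ) ^ (q + 1)))
      atTop (nhds 0) := by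
  have hlim : Tendsto (fun n => ((1 / 2 : ℝ) ^ (2 * q + 1) * (b n * (T n : ℝ) ^ q))⁻¹)
      atTop (nhds 0) :=
    tendsto_inv_atTop_zero.comp (hbT.const_mul_atTop (by positivity))
  refine squeeze_zero' (Eventually.of_forall fun n => ?_) ?_ hlim
  · have := hb n
    positivity
  filter_upwards [hbT.eventually_gt_atTop 0] with n hn
  have hTpos : (0 : ℝ) < (T n : ℝ) := by
    have := hT2 n
    exact_mod_cast (by omega : 0 < T n)
  obtain ⟨m, hm⟩ := hTeven n
  have hm2 : (m : ℝ) = 1 / 2 * (T n : ℝ) := by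
    rw [hm]; push_cast; ring
  have hmem : m ∈ Finset.range (T n) := by
    have := hT2 n
    rw [Finset.mem_range]; omega
  have hsum : (1 / 2 : ℝ) ^ (2 * q + 1) * ((T n : ℝ) ^ q * (T n : ℝ) ^ (q + 1)) ≤
      ∑ s ∈ Finset.range (T n), (s : ℝ) ^ q * ((T n - s : ℕ) : ℝ) ^ (q + 1) := by
    have h := Finset.single_le_sum
      (f := fun s : ℕ => (s : ℝ) ^ q * ((T n - s : ℕ) : ℝ) ^ (q + 1))
      (fun i _ => by positivity) hmem
    refine le_trans (le_of_eq ?_) h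
    have h2 : T n - m = m := by omega
    simp only [h2, hm2, mul_pow]
    ring
  have hbs := mul_le_mul_of_nonneg_left hsum (hb n)
  have hP : (0 : ℝ) < (T n : ℝ) ^ (q + 1) := by positivity
  have hX : 0 < (1 / 2 : ℝ) ^ (2 * q + 1) * (b n * (T n : ℝ) ^ q) := by positivity
  have hden : (T n : ℝ) ^ (q + 1) * ((1 / 2 : ℝ) ^ (2 * q + 1) * (b n * (T n : ℝ) ^ q)) ≤
      (T n : ℝ) ^ (q + 1) +
        b n * ∑ s ∈ Finset.range (T n), (s : ℝ) ^ q * ((T n - s : ℕ) : ℝ) ^ (q + 1) := by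
    calc _ = b n * ((1 / 2 : ℝ) ^ (2 * q + 1) * ((T n : ℝ) ^ q * (T n : ℝ) ^ (q + 1))) := by ring
      _ ≤ _ := by linarith
  rw [inv_eq_one_div, div_le_div_iff₀ (lt_of_lt_of_le (mul_pos hP hX) hden) hX, one_mul]
  exact hden
end
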